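/- Let ν = (ν_1 > ⋯ > ν_r > 0) be a strict partition of length r ≤ n and define the factorial Schur Q-polynomial Q_ν(x_n|b) := Σ_{w∈C(r,n)} w·( ∏_{i=1}^{r} 2x_i ∏_{j=1}^{ν_i−1} (x_i + b_j) · ∏_{i=1}^{r} ∏_{j=i+1}^{n} (x_i + x_j)/(x_i − x_j) ). Then Q_ν(x_n|b) = [u_1^{−ν_1}⋯u_r^{−ν_r}]( ∏_{i=1}^{r} ( ∏_{j=1}^{n} (u_i + x_j)/(u_i − x_j) · ∏_{j=1}^{ν_i−1} (u_i + b_j)/u_i ) · ∏_{1≤i<j≤r} (u_j − u_i)/(u_j + u_i) ), the coefficient being taken in Λ. This is the additive specialization of the generating-function theorem for the universal factorial Schur Q-functions. -/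

import Mathlib

open Finset

noncomputable section

instance finWF (r : ℕ) : WellFoundedLT (Fin r) :=
  inferInstanceAs (IsWellFounded (Fin r) (· < ·))

/-- The field `ℚ(x_1, …, x_n, b_1, b_2, …)` of rational functions. -/
abbrev K (n : ℕ) : Type := FractionRing (MvPolynomial (Fin n ⊕ ℕ) ℚ)

/-- The indeterminate `x_i` (`0`-indexed). -/
def x (n : ℕ) (i : Fin n) : K n :=
  algebraMap (MvPolynomial (Fin n ⊕ ℕ) ℚ) (K n) (MvPolynomial.X (Sum.inl i))

/-- The indeterminate `b_{j+1}` (so `b 0 = b_1`, …). -/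
def b (n : ℕ) (j : ℕ) : K n :=
  algebraMap (MvPolynomial (Fin n ⊕ ℕ) ℚ) (K n) (MvPolynomial.X (Sum.inr j))

/-- The coset representatives `C(r,n)`. -/
def Cperm (r n : ℕ) : Finset (Equiv.Perm (Fin n)) :=
  Finset.univ.filter fun w => ∀ i j : Fin n, r ≤ (i : ℕ) → i < j → w i < w j

/-- The iterated formal Laurent series field `Λ = K((u_1⁻¹))⋯((u_r⁻¹))`, realized inside the
Hahn series field over the lexicographically ordered group `ℤ^r`. -/
abbrev H (n r : ℕ) := HahnSeries (Lex (Fin r → ℤ)) (K n)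

/-- The variable `u_i` (`0`-indexed). -/
def u (n r : ℕ) (i : Fin r) : H n r :=
  HahnSeries.single (toLex (Pi.single (Fin.rev i) (-1 : ℤ))) 1

open Polynomial in
/-- Partial fraction decomposition with simple poles, evaluated at a point of an extension field. -/
lemma exists_partial_fractions {S H ι : Type*} [Field S] [Field H] [DecidableEq ι] (f : S →+* H)
    (s : Finset ι) (c : ι → S) (hc : Set.InjOn c s) (N : S[X]) (U : H) (hU : ∀ a ∈ s, U ≠ f (c a)) :
    ∃ Q : S[X], N.eval₂ f U / ∏ a ∈ s, (U - f (c a)) =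
      Q.eval₂ f U + ∑ a ∈ s,
        f (N.eval (c a) / ∏ b ∈ s.erase a, (c a - c b)) / (U - f (c a)) := by
  set L : S[X] := ∑ a ∈ s, C (N.eval (c a) / ∏ b ∈ s.erase a, (c a - c b)) *
    ∏ b ∈ s.erase a, (X - C (c b)) with hL
  have hdvd : ∏ a ∈ s, (X - C (c a)) ∣ N - L := by
    apply Finset.prod_dvd_of_coprime
    · intro a ha b hb hab
      exact isCoprime_X_sub_C_of_isUnit_sub (sub_ne_zero.2 fun h => hab (hc ha hb h)).isUnit
    · intro a ha
      rw [dvd_iff_isRoot, IsRoot, eval_sub, hL, eval_finsetSum, Finset.sum_eq_single a]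
      · have : ∏ b ∈ s.erase a, (c a - c b) ≠ 0 := Finset.prod_ne_zero_iff.2 fun b hb =>
          sub_ne_zero.2 fun h => (Finset.mem_erase.1 hb).1 (hc (Finset.mem_erase.1 hb).2 ha h.symm)
        simp [eval_prod, this]
      · intro b _ hba
        have : ∏ j ∈ s.erase b, eval (c a) (X - C (c j)) = 0 :=
          Finset.prod_eq_zero (i := a) (Finset.mem_erase.2 ⟨hba.symm, ha⟩) (by simp)
        rw [eval_mul, eval_prod, this, mul_zero]
      · exact fun h => absurd ha h
  obtain ⟨Q, hQ⟩ := hdvd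
  refine ⟨Q, ?_⟩
  have hne : ∀ a ∈ s, U - f (c a) ≠ 0 := fun a ha => sub_ne_zero.2 (hU a ha)
  have hN : N.eval₂ f U = Q.eval₂ f U * ∏ a ∈ s, (U - f (c a)) + L.eval₂ f U := by
    conv_lhs => rw [eq_add_of_sub_eq hQ, eval₂_add, eval₂_mul, eval₂_finsetProd, mul_comm]
    simp
  rw [div_eq_iff (Finset.prod_ne_zero_iff.2 hne), add_mul, Finset.sum_mul, hN, hL,
    eval₂_finsetSum]
  congr 1
  refine Finset.sum_congr rfl fun a ha => ?_
  rw [← Finset.mul_prod_erase s _ ha, eval₂_mul, eval₂_finsetProd, eval₂_C, div_mul_eq_mul_div,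
    eq_div_iff (hne a ha)]
  simp only [eval₂_sub, eval₂_X, eval₂_C]
  ring

/-- The formal properties of an iterated Laurent series field `C((v₀⁻¹))⋯((v_{r-1}⁻¹))` needed to
compute residues: `free l` is the subfield of series not involving `v l`, and `φ` extracts the
coefficient of `v₀⁻¹⋯v_{r-1}⁻¹`. -/
structure IteratedResidue (K H : Type*) [Field K] [Field H] (r : ℕ) where
  C : K →+* H
  v : ℕ → H
  free : ℕ → Subfield H
  φ : H →+ K
  C_mem : ∀ l a, C a ∈ free l
  v_mem : ∀ i l, i ≠ l → v i ∈ free l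
  φ_C_mul : ∀ a f, φ (C a * f) = a * φ f
  φ_mul_pow : ∀ l < r, ∀ A ∈ free l, ∀ j : ℕ, φ (A * v l ^ j) = 0
  φ_div_sub : ∀ k < r, ∀ A c, (∀ l, k ≤ l → l < r → A ∈ free l) →
    (∀ l, k ≤ l → l < r → c ∈ free l) →
    φ (A / (v k - c) * ∏ i ∈ Finset.Ico (k + 1) r, (v i)⁻¹) =
      φ (A / v k * ∏ i ∈ Finset.Ico (k + 1) r, (v i)⁻¹)
  φ_one : φ (∏ i ∈ Finset.Ico 0 r, (v i)⁻¹) = 1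

namespace IteratedResidue

variable {K H : Type*} [Field K] [Field H] {r : ℕ} (D : IteratedResidue K H r)

/-- The product of the inverses of the last `r - k` variables. -/
def tail (k : ℕ) : H := ∏ i ∈ Finset.Ico k r, (D.v i)⁻¹

lemma tail_eq {k : ℕ} (hk : k < r) : D.tail k = (D.v k)⁻¹ * D.tail (k + 1) :=
  Finset.prod_eq_prod_Ico_succ_bot hk _

lemma tail_mem {k l : ℕ} (h : l < k) : D.tail k ∈ D.free l :=
  prod_mem fun i hi => inv_mem (D.v_mem i l (by have := Finset.mem_Ico.1 hi; omega))

lemma v_notMem {l : ℕ} (hl : l < r) : D.v l ∉ D.free l := by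
  intro h
  have h1 : ∏ i ∈ Finset.Ico 0 r, (D.v i)⁻¹ ∈ D.free l := prod_mem fun i _ => inv_mem <| by
    rcases eq_or_ne i l with rfl | hi
    · exact h
    · exact D.v_mem i l hi
  have h2 := D.φ_mul_pow l hl _ h1 0
  rw [pow_zero, mul_one, D.φ_one] at h2
  exact one_ne_zero h2

lemma φ_mul_eval₂ {R : Type*} [Semiring R] {f : R →+* H} {l : ℕ} (hl : l < r)
    (hf : ∀ a, f a ∈ D.free l) {A : H} (hA : A ∈ D.free l) (Q : Polynomial R) :
    D.φ (A * Q.eval₂ f (D.v l)) = 0 := by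
  rw [Polynomial.eval₂_eq_sum_range, Finset.mul_sum, map_sum]
  refine Finset.sum_eq_zero fun j _ => ?_
  rw [← mul_assoc]
  exact D.φ_mul_pow l hl _ (mul_mem hA (hf _)) j

/-- The subfield of series involving only the first `k` variables. -/
def first (k : ℕ) : Subfield H := ⨅ l : Set.Ico k r, D.free l

lemma mem_first {k : ℕ} {a : H} : a ∈ D.first k ↔ ∀ l, k ≤ l → l < r → a ∈ D.free l := by
  simp [first, Subfield.mem_iInf]

open Polynomial in
/-- Taking the residue in the variable `v k`. -/
lemma φ_residue {ι : Type*} [DecidableEq ι] {k : ℕ} (hk : k < r) (s : Finset ι)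
    (c : ι → D.first k) (hc : Set.InjOn c s) (N : (D.first k)[X]) {A : H} (hA : A ∈ D.first k) :
    D.φ (A * (N.eval₂ (D.first k).subtype (D.v k) / ∏ a ∈ s, (D.v k - c a)) * D.tail (k + 1)) =
      ∑ a ∈ s, D.φ (A * ((N.eval (c a) / ∏ b ∈ s.erase a, (c a - c b) : D.first k) : H) *
        D.tail k) := by
  have hsub : ∀ a : D.first k, (a : H) ∈ D.free k := fun a => D.mem_first.1 a.2 k le_rfl hk
  obtain ⟨Q, hQ⟩ := exists_partial_fractions (D.first k).subtype s c hc N (D.v k)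
    (fun a _ h => D.v_notMem hk (h ▸ hsub (c a)))
  simp only [Subfield.subtype_apply] at hQ
  rw [hQ, mul_add, add_mul, map_add, mul_right_comm,
    D.φ_mul_eval₂ hk hsub (mul_mem (D.mem_first.1 hA k le_rfl hk) (D.tail_mem (Nat.lt_succ_self k))),
    zero_add, Finset.mul_sum, Finset.sum_mul, map_sum]
  refine Finset.sum_congr rfl fun a _ => ?_
  rw [← mul_div_assoc, tail, D.φ_div_sub k hk _ _
    (D.mem_first.1 (mul_mem hA (SetLike.coe_mem _))) (D.mem_first.1 (c a).2), D.tail_eq hk, tail,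
    div_eq_mul_inv, mul_assoc]

/-- `∏ (t + x_a) / (t - x_a)` over `a ∈ X`. -/
def quot {σ : Type*} (x : σ → K) (X : Finset σ) (t : H) : H :=
  ∏ a ∈ X, (t + D.C (x a)) / (t - D.C (x a))

/-- The generating function in the first `k` variables. -/
def body {σ : Type*} (x : σ → K) (P : ℕ → Polynomial K) (k : ℕ) (X : Finset σ) : H :=
  ∏ i ∈ Finset.range k, (D.quot x X (D.v i) * (P i).eval₂ D.C (D.v i) *
    ∏ j ∈ Finset.range i, (D.v i - D.v j) / (D.v i + D.v j))

lemma eval₂_mem {S : Subfield H} {t : H} (ht : t ∈ S) (hS : ∀ a, D.C a ∈ S) (Q : Polynomial K) :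
    Q.eval₂ D.C t ∈ S := by
  rw [Polynomial.eval₂_eq_sum_range]
  exact sum_mem fun j _ => mul_mem (hS _) (pow_mem ht j)

variable {σ : Type*} (x : σ → K) (P : ℕ → Polynomial K)

lemma quot_mem {S : Subfield H} {t : H} (ht : t ∈ S) (hS : ∀ a, D.C a ∈ S) (X : Finset σ) :
    D.quot x X t ∈ S :=
  prod_mem fun _ _ => div_mem (add_mem ht (hS _)) (sub_mem ht (hS _))

lemma factor_mem {l i : ℕ} (h : l < i) (X : Finset σ) :
    D.quot x X (D.v i) * (P i).eval₂ D.C (D.v i) ∈ D.free l :=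
  mul_mem (D.quot_mem x (D.v_mem i l h.ne') (D.C_mem l) X)
    (D.eval₂_mem (D.v_mem i l h.ne') (D.C_mem l) _)

lemma body_mem_free {k l : ℕ} (h : k ≤ l) (X : Finset σ) : D.body x P k X ∈ D.free l := by
  refine prod_mem fun i hi => ?_
  have hv : ∀ j < k, D.v j ∈ D.free l := fun j hj => D.v_mem j l (by omega)
  have hi' := Finset.mem_range.1 hi
  refine mul_mem (mul_mem (D.quot_mem x (hv i hi') (D.C_mem l) X)
    (D.eval₂_mem (hv i hi') (D.C_mem l) _)) (prod_mem fun j hj => ?_)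
  have hj' := Finset.mem_range.1 hj
  exact div_mem (sub_mem (hv i hi') (hv j (by omega))) (add_mem (hv i hi') (hv j (by omega)))

/-- Isolating the variable `v l` in the generating function. -/
lemma exists_body_eq {k l : ℕ} (h : l < k) (X : Finset σ) :
    ∃ B ∈ D.free l, D.body x P k X = B * (D.quot x X (D.v l) * (P l).eval₂ D.C (D.v l) *
      ∏ j ∈ (Finset.range k).erase l, (D.v l - D.v j) / (D.v l + D.v j)) := by
  induction k, h using Nat.le_induction with
  | base =>
    refine ⟨D.body x P l X, D.body_mem_free x P le_rfl X, ?_⟩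
    rw [body, Finset.prod_range_succ, Finset.range_add_one, Finset.erase_insert (by simp), body]
  | succ k hk ih =>
    obtain ⟨B, hB, hBeq⟩ := ih
    have hlk : l < k := hk
    have hmem : ∏ j ∈ (Finset.range k).erase l, (D.v k - D.v j) / (D.v k + D.v j) ∈ D.free l :=
      prod_mem fun j hj => by
        have hv := D.v_mem k l hlk.ne'
        have hv' := D.v_mem j l (Finset.ne_of_mem_erase hj)
        exact div_mem (sub_mem hv hv') (add_mem hv hv')
    refine ⟨_, neg_mem (mul_mem hB (mul_mem (D.factor_mem x P hlk X) hmem)), ?_⟩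
    have hk' : k ∉ (Finset.range k).erase l := by simp
    rw [body, Finset.prod_range_succ, ← body, hBeq, Finset.range_add_one,
      Finset.erase_insert_of_ne hlk.ne', Finset.prod_insert hk',
      ← Finset.mul_prod_erase (Finset.range k) _ (Finset.mem_range.2 hlk)]
    rw [← neg_sub (D.v l) (D.v k), add_comm (D.v k) (D.v l), neg_div]
    ring

lemma φ_residue_prod {ι : Type*} [DecidableEq ι] {k : ℕ} (hk : k < r) (s : Finset ι)
    (c : ι → H) (hcm : ∀ a, c a ∈ D.first k) (hc : Set.InjOn c s) (p : Polynomial K) {A : H}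
    (hA : A ∈ D.first k) :
    D.φ (A * (p.eval₂ D.C (D.v k) * ∏ a ∈ s, (D.v k + c a) / (D.v k - c a)) * D.tail (k + 1)) =
      ∑ a ∈ s, D.φ (A * (2 * c a * p.eval₂ D.C (c a) *
        ∏ b ∈ s.erase a, (c a + c b) / (c a - c b)) * D.tail k) := by
  let c' : ι → D.first k := fun a => ⟨c a, hcm a⟩
  let C' : K →+* D.first k :=
    D.C.codRestrict (D.first k) fun a => D.mem_first.2 fun l _ _ => D.C_mem l a
  have hC' : (D.first k).subtype.comp C' = D.C := rfl
  have := D.φ_residue hk s c' (fun a ha b hb h => hc ha hb (congrArg Subtype.val h))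
    (p.map C' * ∏ a ∈ s, (Polynomial.X + Polynomial.C (c' a))) hA
  convert this using 3
  · congr 2
    rw [Polynomial.eval₂_mul, Polynomial.eval₂_map, hC', Polynomial.eval₂_finsetProd, mul_div_assoc,
      Finset.prod_div_distrib]
    simp [c']
  · rename_i a ha
    congr 2
    rw [Polynomial.eval_mul, Polynomial.eval_map, Polynomial.eval_prod,
      ← Finset.mul_prod_erase s _ ha, Finset.prod_div_distrib]
    have h1 : ((p.eval₂ C' (c' a) : D.first k) : H) = p.eval₂ D.C (c a) :=
      Polynomial.hom_eval₂ p C' (D.first k).subtype (c' a)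
    push_cast
    rw [h1]
    simp [c']
    ring

lemma v_sub_add_C_ne_zero {l : ℕ} (hl : l < r) (a : K) : D.v l - D.C a ≠ 0 ∧ D.v l + D.C a ≠ 0 := by
  refine ⟨fun h => D.v_notMem hl ?_, fun h => D.v_notMem hl ?_⟩
  · rw [sub_eq_zero.1 h]
    exact D.C_mem l a
  · rw [eq_neg_of_add_eq_zero_left h]
    exact neg_mem (D.C_mem l a)

lemma v_sub_add_ne_zero {l i : ℕ} (hl : l < r) (hi : i ≠ l) :
    D.v l - D.v i ≠ 0 ∧ D.v l + D.v i ≠ 0 := by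
  refine ⟨fun h => D.v_notMem hl ?_, fun h => D.v_notMem hl ?_⟩
  · rw [sub_eq_zero.1 h]
    exact D.v_mem i l hi
  · rw [eq_neg_of_add_eq_zero_left h]
    exact neg_mem (D.v_mem i l hi)

/-- The residues at `v k = -v l` do not contribute. -/
lemma φ_residue_neg {k l : ℕ} (hk : k < r) (hl : l < k) (X : Finset σ) :
    D.φ (D.body x P k X * (2 * (-D.v l) * (P k).eval₂ D.C (-D.v l) *
      (D.quot x X (-D.v l) * ∏ j ∈ (Finset.range k).erase l, (-D.v l - D.v j) / (-D.v l + D.v j))) *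
        D.tail k) = 0 := by
  obtain ⟨B, hB, hBeq⟩ := D.exists_body_eq x P hl X
  have hlr : l < r := hl.trans hk
  have h1 : D.quot x X (D.v l) * D.quot x X (-D.v l) = 1 := by
    rw [quot, quot, ← Finset.prod_mul_distrib]
    refine Finset.prod_eq_one fun a _ => ?_
    obtain ⟨h1, h2⟩ := D.v_sub_add_C_ne_zero hlr (x a)
    rw [← neg_add', neg_add_eq_sub, ← neg_sub (D.v l) (D.C (x a)), neg_div_neg_eq]
    field_simp
  have h2 : (∏ j ∈ (Finset.range k).erase l, (D.v l - D.v j) / (D.v l + D.v j)) *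
      ∏ j ∈ (Finset.range k).erase l, (-D.v l - D.v j) / (-D.v l + D.v j) = 1 := by
    rw [← Finset.prod_mul_distrib]
    refine Finset.prod_eq_one fun j hj => ?_
    obtain ⟨h1, h2⟩ := D.v_sub_add_ne_zero hlr (Finset.ne_of_mem_erase hj)
    rw [← neg_add', neg_add_eq_sub, ← neg_sub (D.v l) (D.v j), neg_div_neg_eq]
    field_simp
  have h3 := D.φ_mul_eval₂ hlr (D.C_mem l) (mul_mem hB (D.tail_mem hl))
    (Polynomial.C (-2) * Polynomial.X * P l * (P k).comp (-Polynomial.X))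
  rw [← h3, hBeq]
  congr 1
  have h4 : ((P k).comp (-Polynomial.X)).eval₂ D.C (D.v l) = (P k).eval₂ D.C (-D.v l) := by
    rw [Polynomial.eval₂_comp, Polynomial.eval₂_neg, Polynomial.eval₂_X]
  rw [Polynomial.eval₂_mul, Polynomial.eval₂_mul, Polynomial.eval₂_mul, h4, Polynomial.eval₂_C,
    Polynomial.eval₂_X, map_neg, map_ofNat]
  linear_combination (-2 * B * D.tail k * D.v l * (P l).eval₂ D.C (D.v l) *
    (P k).eval₂ D.C (-D.v l)) * ((∏ j ∈ (Finset.range k).erase l, (D.v l - D.v j) / (D.v l + D.v j)) *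
      (∏ j ∈ (Finset.range k).erase l, (-D.v l - D.v j) / (-D.v l + D.v j)) * h1 + h2)

lemma body_mem_first {k : ℕ} (X : Finset σ) : D.body x P k X ∈ D.first k :=
  D.mem_first.2 fun _ h _ => D.body_mem_free x P h X

/-- Removing `a` from `X`, after taking the residue at `v k = x_a`. -/
lemma body_mul_prod [DecidableEq σ] {k : ℕ} (hk : k ≤ r) {X : Finset σ} {a : σ} (ha : a ∈ X) :
    D.body x P k X * ∏ i ∈ Finset.range k, (D.C (x a) - D.v i) / (D.C (x a) + D.v i) =
      (-1) ^ k * D.body x P k (X.erase a) := by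
  have hs : (-1 : H) ^ k = ∏ _i ∈ Finset.range k, -1 := by simp
  rw [body, body, hs, ← Finset.prod_mul_distrib, ← Finset.prod_mul_distrib]
  refine Finset.prod_congr rfl fun i hi => ?_
  obtain ⟨h1, h2⟩ := D.v_sub_add_C_ne_zero ((Finset.mem_range.1 hi).trans_le hk) (x a)
  rw [quot, ← Finset.mul_prod_erase X _ ha, ← quot, add_comm (D.C (x a)) (D.v i)]
  have : (D.v i + D.C (x a)) / (D.v i - D.C (x a)) * ((D.C (x a) - D.v i) / (D.v i + D.C (x a))) =
      -1 := by
    field_simp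
    ring
  linear_combination (D.quot x (X.erase a) (D.v i) * (P i).eval₂ D.C (D.v i) *
    ∏ j ∈ Finset.range i, (D.v i - D.v j) / (D.v i + D.v j)) * this

/-- Recursion for the iterated residues. -/
theorem φ_body_succ [DecidableEq σ] (hx : Function.Injective x) {k : ℕ} (hk : k < r)
    (X : Finset σ) :
    D.φ (D.body x P (k + 1) X * D.tail (k + 1)) =
      ∑ a ∈ X, (-1) ^ k * (2 * x a * (P k).eval (x a) *
        ∏ b ∈ X.erase a, (x a + x b) / (x a - x b)) *
          D.φ (D.body x P k (X.erase a) * D.tail k) := by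
  let c : σ ⊕ ℕ → H := Sum.elim (fun a => D.C (x a)) (fun i => if i < k then -D.v i else 0)
  have hcm : ∀ a, c a ∈ D.first k := by
    rintro (a | i) <;> refine D.mem_first.2 fun l hl _ => ?_
    · exact D.C_mem l _
    · by_cases h : i < k
      · simpa [c, h] using D.v_mem i l (by omega)
      · simp [c, h]
  have hci : ∀ i, i < k → c (Sum.inr i) = -D.v i := fun i hi => by simp [c, hi]
  have hc : Set.InjOn c (X.disjSum (Finset.range k)) := by
    have hne : ∀ a i, i < k → D.C (x a) ≠ -D.v i := fun a i hi h =>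
      (D.v_sub_add_C_ne_zero (hi.trans hk) (x a)).2 (by rw [h]; ring)
    rintro (a | i) ha (b | j) hb h
    · exact congrArg _ (hx (D.C.injective h))
    · have hj : j < k := by simpa using hb
      exact absurd (h.trans (hci j hj)) (hne a j hj)
    · have hj : i < k := by simpa using ha
      exact absurd (h.symm.trans (hci i hj)) (hne b i hj)
    · have hi : i < k := by simpa using ha
      have hj : j < k := by simpa using hb
      rw [hci i hi, hci j hj] at h
      by_contra hij
      have hij' : i ≠ j := fun h => hij (congrArg _ h)
      exact (D.v_sub_add_ne_zero (hj.trans hk) hij').1 (by linear_combination h)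
  have key := D.φ_residue_prod hk (X.disjSum (Finset.range k)) c hcm hc (P k)
    (D.body_mem_first x P X)
  have h1 : D.body x P (k + 1) X = D.body x P k X * ((P k).eval₂ D.C (D.v k) *
      ∏ a ∈ X.disjSum (Finset.range k), (D.v k + c a) / (D.v k - c a)) := by
    have h2 : ∏ i ∈ Finset.range k, (D.v k + c (Sum.inr i)) / (D.v k - c (Sum.inr i)) =
        ∏ i ∈ Finset.range k, (D.v k - D.v i) / (D.v k + D.v i) :=
      Finset.prod_congr rfl fun i hi => by rw [hci i (Finset.mem_range.1 hi)]; ring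
    rw [Finset.prod_disjSum, h2, body, Finset.prod_range_succ, ← body, quot]
    simp only [c, Sum.elim_inl]
    ring
  rw [h1, key, Finset.sum_disjSum, Finset.sum_eq_zero (s := Finset.range k), add_zero]
  · refine Finset.sum_congr rfl fun a ha => ?_
    have h2 : (X.disjSum (Finset.range k)).erase (Sum.inl a) =
        (X.erase a).disjSum (Finset.range k) := by
      ext (b | i) <;> simp
    have h3 : ∏ i ∈ Finset.range k, (D.C (x a) + c (Sum.inr i)) / (D.C (x a) - c (Sum.inr i)) =
        ∏ i ∈ Finset.range k, (D.C (x a) - D.v i) / (D.C (x a) + D.v i) :=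
      Finset.prod_congr rfl fun i hi => by rw [hci i (Finset.mem_range.1 hi)]; ring
    rw [h2, Finset.prod_disjSum]
    simp only [c, Sum.elim_inl] at h3 ⊢
    rw [h3, ← D.φ_C_mul]
    congr 1
    have h4 := D.body_mul_prod x P hk.le ha
    simp only [map_mul, map_pow, map_neg, map_one, map_ofNat, map_prod, map_div₀, map_add, map_sub]
    rw [show D.C ((P k).eval (x a)) = (P k).eval₂ D.C (D.C (x a)) from
      (Polynomial.eval₂_at_apply _ _).symm]
    linear_combination (2 * D.C (x a) * (P k).eval₂ D.C (D.C (x a)) * D.tail k *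
      ∏ b ∈ X.erase a, (D.C (x a) + D.C (x b)) / (D.C (x a) - D.C (x b))) * h4
  · intro l hl
    have hl' := Finset.mem_range.1 hl
    have h2 : (X.disjSum (Finset.range k)).erase (Sum.inr l) =
        X.disjSum ((Finset.range k).erase l) := by
      ext (b | i) <;> simp
    have h3 : ∏ j ∈ (Finset.range k).erase l, (-D.v l + c (Sum.inr j)) / (-D.v l - c (Sum.inr j)) =
        ∏ j ∈ (Finset.range k).erase l, (-D.v l - D.v j) / (-D.v l + D.v j) :=
      Finset.prod_congr rfl fun i hi => by
        rw [hci i (Finset.mem_range.1 (Finset.mem_of_mem_erase hi))]; ring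
    rw [h2, hci l hl', Finset.prod_disjSum, h3]
    exact D.φ_residue_neg x P hk hl' X

/-- The iterated residue at `v i = x (f i)`. -/
def residueTerm [DecidableEq σ] (k : ℕ) (X : Finset σ) (f : Fin k → σ) : K :=
  ∏ i : Fin k, (2 * x (f i) * (P i).eval (x (f i)) *
    ∏ b ∈ X.filter (fun b => ∀ j ≤ i, f j ≠ b), (x (f i) + x b) / (x (f i) - x b))

lemma residueTerm_snoc [DecidableEq σ] {k : ℕ} {X : Finset σ} {a : σ} (ha : a ∈ X)
    {f : Fin k → σ} (hf : Function.Injective f) (hfX : ∀ i, f i ∈ X.erase a) :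
    residueTerm x P (k + 1) X (Fin.snoc f a : Fin (k + 1) → σ) =
      (-1) ^ k * (2 * x a * (P k).eval (x a) *
        ∏ b ∈ X.erase a, (x a + x b) / (x a - x b)) * residueTerm x P k (X.erase a) f := by
  have h1 : ∀ i : Fin k, X.filter (fun b => ∀ j ≤ i.castSucc, (Fin.snoc f a : Fin (k + 1) → σ) j ≠ b)
      = insert a ((X.erase a).filter (fun b => ∀ j ≤ i, f j ≠ b)) := by
    intro i
    ext b
    have : (∀ j ≤ i.castSucc, (Fin.snoc f a : Fin (k + 1) → σ) j ≠ b) ↔ ∀ j ≤ i, f j ≠ b := by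
      rw [Fin.forall_fin_succ']
      simp [Fin.snoc_castSucc, Fin.castSucc_le_castSucc_iff, (Fin.castSucc_lt_last i).not_ge]
    simp only [Finset.mem_filter, Finset.mem_insert, Finset.mem_erase, this]
    constructor
    · rintro ⟨hb, h⟩
      by_cases hba : b = a <;> simp_all
    · rintro (rfl | ⟨⟨_, hb⟩, h⟩)
      · exact ⟨ha, fun j _ h => (Finset.mem_erase.1 (hfX j)).1 h⟩
      · exact ⟨hb, h⟩
  have h2 : X.filter (fun b => ∀ j ≤ Fin.last k, (Fin.snoc f a : Fin (k + 1) → σ) j ≠ b) =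
      (X.erase a).filter (fun b => ∀ j, f j ≠ b) := by
    ext b
    simp only [Finset.mem_filter, Finset.mem_erase, Fin.le_last, true_imp_iff,
      Fin.forall_fin_succ', Fin.snoc_castSucc, Fin.snoc_last]
    grind
  have h3 : (X.erase a).filter (fun b => ¬ ∀ j, f j ≠ b) = Finset.univ.image f := by
    ext b
    simp only [Finset.mem_filter, Finset.mem_image, Finset.mem_univ, true_and]
    push Not
    exact ⟨fun h => h.2, fun h => ⟨by obtain ⟨j, rfl⟩ := h; exact hfX j, h⟩⟩
  have h4 := Finset.prod_filter_mul_prod_filter_not (X.erase a) (fun b => ∀ j, f j ≠ b)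
    (fun b => (x a + x b) / (x a - x b))
  rw [h3, Finset.prod_image hf.injOn] at h4
  have h5 : ∏ i : Fin k, (x (f i) + x a) / (x (f i) - x a) =
      (-1) ^ k * ∏ i : Fin k, (x a + x (f i)) / (x a - x (f i)) := by
    have hs : (-1 : K) ^ k = ∏ _i : Fin k, -1 := by simp
    rw [hs, ← Finset.prod_mul_distrib]
    refine Finset.prod_congr rfl fun i _ => ?_
    rw [← neg_sub (x a), div_neg, add_comm, neg_one_mul]
  rw [residueTerm, Fin.prod_univ_castSucc]
  simp only [h1, h2, Fin.snoc_castSucc, Fin.snoc_last, Fin.val_castSucc, Fin.val_last]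
  have h6 : ∀ i : Fin k, ∏ b ∈ insert a ((X.erase a).filter (fun b => ∀ j ≤ i, f j ≠ b)),
      (x (f i) + x b) / (x (f i) - x b) = (x (f i) + x a) / (x (f i) - x a) *
        ∏ b ∈ (X.erase a).filter (fun b => ∀ j ≤ i, f j ≠ b),
          (x (f i) + x b) / (x (f i) - x b) := fun i => Finset.prod_insert (by simp)
  simp only [h6, mul_left_comm _ ((_ + x a) / (_ - x a))]
  rw [Finset.prod_mul_distrib, h5, ← residueTerm, ← h4]
  ring

theorem φ_body_eq_sum [Fintype σ] [DecidableEq σ] (hx : Function.Injective x) {k : ℕ} (hk : k ≤ r)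
    (X : Finset σ) :
    D.φ (D.body x P k X * D.tail k) =
      ∑ f : Fin k → σ with Function.Injective f ∧ ∀ i, f i ∈ X, residueTerm x P k X f := by
  induction k generalizing X with
  | zero =>
    rw [body, Finset.range_zero, Finset.prod_empty, one_mul, tail, D.φ_one]
    simp [residueTerm, Function.injective_of_subsingleton]
  | succ k ih =>
    rw [D.φ_body_succ x P hx hk]
    simp_rw [ih (Nat.le_of_succ_le hk), Finset.mul_sum]
    rw [Finset.sum_sigma']
    refine Finset.sum_bij' (fun p _ => (Fin.snoc p.2 p.1 : Fin (k + 1) → σ))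
      (fun f _ => ⟨f (Fin.last k), Fin.init f⟩) ?_ ?_ ?_ ?_ ?_
    · rintro ⟨a, f⟩ h
      simp only [Finset.mem_sigma, Finset.mem_filter, Finset.mem_univ, true_and,
        Finset.mem_erase] at h ⊢
      refine ⟨Fin.snoc_injective_of_injective h.2.1 ?_, ?_⟩
      · rintro ⟨i, hi⟩
        exact (h.2.2 i).1 hi
      · rw [Fin.forall_fin_succ']
        simpa [h.1] using fun i => (h.2.2 i).2
    · intro f h
      simp only [Finset.mem_sigma, Finset.mem_filter, Finset.mem_univ, true_and,
        Finset.mem_erase] at h ⊢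
      exact ⟨h.2 _, h.1.comp (Fin.castSucc_injective k),
        fun i => ⟨fun hi => (Fin.castSucc_lt_last i).ne (h.1 hi), h.2 _⟩⟩
    · rintro ⟨a, f⟩ _
      simp
    · intro f _
      simp
    · rintro ⟨a, f⟩ h
      simp only [Finset.mem_sigma, Finset.mem_filter, Finset.mem_univ, true_and] at h
      exact (residueTerm_snoc x P h.1 h.2.1 h.2.2).symm

end IteratedResidue

section Instance

variable (n r : ℕ)

/-- A coordinate of an exponent. -/
def coord (m : Fin r) : Lex (Fin r → ℤ) →+ ℤ where
  toFun g := ofLex g m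
  map_zero' := rfl
  map_add' _ _ := rfl

/-- The exponent of the inverse of the `i`-th variable. -/
def expo (i : ℕ) : Lex (Fin r → ℤ) := toLex fun m => if (m : ℕ) + i + 1 = r then 1 else 0

/-- The exponent of the inverse of the product of all variables. -/
def onesExp : Lex (Fin r → ℤ) := toLex fun _ => 1

variable {r}

lemma coord_expo (m : Fin r) (i : ℕ) :
    coord r m (expo r i) = if (m : ℕ) + i + 1 = r then 1 else 0 := rfl

lemma coord_onesExp (m : Fin r) : coord r m (onesExp r) = 1 := rfl

lemma lex_ext {g g' : Lex (Fin r → ℤ)} (h : ∀ m, coord r m g = coord r m g') : g = g' :=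
  funext h

lemma lex_lt_of_coord {g g' : Lex (Fin r → ℤ)} (m : Fin r)
    (h : ∀ j < m, coord r j g = coord r j g') (hm : coord r m g < coord r m g') : g < g' :=
  ⟨m, h, hm⟩

lemma coord_sum_expo (m : Fin r) (k : ℕ) :
    coord r m (∑ i ∈ Finset.Ico k r, expo r i) = if (m : ℕ) + k < r then 1 else 0 := by
  rw [map_sum]
  simp only [coord_expo]
  have h : ∀ i, ((m : ℕ) + i + 1 = r) ↔ i = r - 1 - m := fun i => by have := m.2; omega
  simp only [h, Finset.sum_ite_eq', Finset.mem_Ico]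
  have := m.2
  congr 1
  apply propext
  omega

variable (r)

/-- The exponents not involving the `l`-th variable. -/
def freeExp (l : ℕ) : AddSubgroup (Lex (Fin r → ℤ)) where
  carrier := {g | ∀ m : Fin r, (m : ℕ) + l + 1 = r → coord r m g = 0}
  zero_mem' := fun _ _ => rfl
  add_mem' := fun ha hb m hm => by rw [map_add, ha m hm, hb m hm, add_zero]
  neg_mem' := fun ha m hm => by rw [map_neg, ha m hm, neg_zero]

lemma freeExp_subtype_le_iff (l : ℕ) (g g' : freeExp r l) :
    (freeExp r l).subtype g ≤ (freeExp r l).subtype g' ↔ g ≤ g' := Iff.rfl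

/-- The subfield of series not involving the `l`-th variable. -/
def freeSubfield (l : ℕ) : Subfield (H n r) :=
  (HahnSeries.embDomainRingHom (R := K n) (freeExp r l).subtype
    (freeExp r l).subtype_injective (freeExp_subtype_le_iff r l)).fieldRange

/-- The variables, indexed by the natural numbers. -/
def natVar (i : ℕ) : H n r := HahnSeries.single (-expo r i) 1

variable {n r}

lemma coeff_eq_zero_of_mem_freeSubfield {l : ℕ} {f : H n r} (hf : f ∈ freeSubfield n r l)
    {g : Lex (Fin r → ℤ)} (m : Fin r) (hm : (m : ℕ) + l + 1 = r) (hg : coord r m g ≠ 0) :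
    f.coeff g = 0 := by
  obtain ⟨f', rfl⟩ := hf
  refine HahnSeries.embDomain_of_notMem_range ?_
  rintro ⟨g', rfl⟩
  exact hg (g'.2 m hm)

lemma single_mem_freeSubfield {l : ℕ} {g : Lex (Fin r → ℤ)} (hg : g ∈ freeExp r l) (a : K n) :
    HahnSeries.single g a ∈ freeSubfield n r l :=
  ⟨HahnSeries.single ⟨g, hg⟩ a, by
    rw [HahnSeries.embDomainRingHom_apply]
    exact HahnSeries.embDomain_single⟩

lemma coord_order_eq_zero {l : ℕ} {f : H n r} (hf : f ∈ freeSubfield n r l) (m : Fin r)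
    (hm : (m : ℕ) + l + 1 = r) : coord r m f.order = 0 := by
  by_cases h0 : f = 0
  · rw [h0, HahnSeries.order_zero, map_zero]
  by_contra h
  exact h0 (HahnSeries.coeff_order_eq_zero.1 (coeff_eq_zero_of_mem_freeSubfield hf m hm h))

lemma natVar_inv (i : ℕ) : (natVar n r i)⁻¹ = HahnSeries.single (expo r i) 1 := by
  refine inv_eq_of_mul_eq_one_right ?_
  rw [natVar, HahnSeries.single_mul_single, neg_add_cancel, mul_one]
  rfl

lemma prod_natVar_inv (s : Finset ℕ) :
    ∏ i ∈ s, (natVar n r i)⁻¹ = HahnSeries.single (∑ i ∈ s, expo r i) 1 := by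
  induction s using Finset.cons_induction with
  | empty => rfl
  | cons a s ha ih =>
    rw [Finset.prod_cons, Finset.sum_cons, ih, natVar_inv, HahnSeries.single_mul_single, mul_one]

lemma natVar_pow (i j : ℕ) : natVar n r i ^ j = HahnSeries.single (-(j • expo r i)) 1 := by
  rw [natVar, HahnSeries.single_pow, one_pow, neg_nsmul]

lemma expo_mem_freeExp {i l : ℕ} (h : i ≠ l) : expo r i ∈ freeExp r l := fun m hm => by
  rw [coord_expo, if_neg (by omega)]

lemma coeff_div_sub {k : ℕ} (hk : k < r) {A c : H n r}
    (hA : ∀ l, k ≤ l → l < r → A ∈ freeSubfield n r l)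
    (hc : ∀ l, k ≤ l → l < r → c ∈ freeSubfield n r l) :
    (A / (natVar n r k - c) * ∏ i ∈ Finset.Ico (k + 1) r, (natVar n r i)⁻¹).coeff (onesExp r) =
      (A / natVar n r k * ∏ i ∈ Finset.Ico (k + 1) r, (natVar n r i)⁻¹).coeff (onesExp r) := by
  rcases eq_or_ne A 0 with rfl | hA0
  · simp
  rcases eq_or_ne c 0 with rfl | hc0
  · simp
  have hord : ∀ f : H n r, (∀ l, k ≤ l → l < r → f ∈ freeSubfield n r l) → ∀ m : Fin r,
      (m : ℕ) + k + 1 ≤ r → coord r m f.order = 0 := fun f hf m hm =>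
    coord_order_eq_zero (hf (r - 1 - m) (by omega) (by omega)) m (by have := m.2; omega)
  set U := natVar n r k with hU
  have hU0 : U ≠ 0 := HahnSeries.single_ne_zero one_ne_zero
  have hUo : U.order = -expo r k := HahnSeries.order_single one_ne_zero
  let m₀ : Fin r := ⟨r - 1 - k, by omega⟩
  have hm₀ : (m₀ : ℕ) + k + 1 = r := by simp only [m₀]; omega
  have hlt : U.order < c.order := by
    refine lex_lt_of_coord m₀ (fun j hj => ?_) ?_
    · have hj' : (j : ℕ) < m₀ := hj
      rw [hord c hc j (by omega), hUo, map_neg, coord_expo, if_neg (by omega), neg_zero]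
    · rw [hord c hc m₀ hm₀.le, hUo, map_neg, coord_expo, if_pos hm₀]
      norm_num
  have hlt' : U.orderTop < c.orderTop := by
    rw [← HahnSeries.order_eq_orderTop_of_ne_zero hU0, ← HahnSeries.order_eq_orderTop_of_ne_zero hc0]
    exact WithTop.coe_lt_coe.2 hlt
  have hsubT := HahnSeries.orderTop_sub hlt'
  have hsub0 : U - c ≠ 0 := fun h => by
    rw [sub_eq_zero.1 h] at hlt
    exact lt_irrefl _ hlt
  have hsub : (U - c).order = U.order := by
    rw [← HahnSeries.order_eq_orderTop_of_ne_zero hU0,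
      ← HahnSeries.order_eq_orderTop_of_ne_zero hsub0] at hsubT
    exact WithTop.coe_injective hsubT
  rw [prod_natVar_inv]
  set τ := ∑ i ∈ Finset.Ico (k + 1) r, expo r i with hτ
  set T : H n r := HahnSeries.single τ 1 with hT
  have hT0 : T ≠ 0 := HahnSeries.single_ne_zero one_ne_zero
  set g : H n r := A / (U - c) * T - A / U * T with hg
  have hgm : g * ((U - c) * U) = A * c * T := by
    rw [hg]
    field_simp
    ring
  have hg0 : g ≠ 0 := fun h => by
    rw [h, zero_mul] at hgm
    exact mul_ne_zero (mul_ne_zero hA0 hc0) hT0 hgm.symm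
  have hgo := congrArg HahnSeries.order hgm
  rw [HahnSeries.order_mul hg0 (mul_ne_zero hsub0 hU0), HahnSeries.order_mul hsub0 hU0, hsub, hUo,
    HahnSeries.order_mul (mul_ne_zero hA0 hc0) hT0, HahnSeries.order_mul hA0 hc0, hT,
    HahnSeries.order_single one_ne_zero] at hgo
  have hco : ∀ m : Fin r, (m : ℕ) + k + 1 ≤ r → coord r m g.order =
      2 * (if (m : ℕ) + k + 1 = r then 1 else 0) + if (m : ℕ) + (k + 1) < r then 1 else 0 := by
    intro m hm
    have := congrArg (coord r m) hgo
    rw [map_add, map_add, map_neg, map_add, map_add, hord A hA m hm, hord c hc m hm, coord_expo, hτ,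
      coord_sum_expo] at this
    linarith
  have : g.coeff (onesExp r) = 0 := by
    refine HahnSeries.coeff_eq_zero_of_lt_order (lex_lt_of_coord m₀ (fun j hj => ?_) ?_)
    · have hj' : (j : ℕ) < m₀ := hj
      rw [coord_onesExp, hco j (by omega), if_neg (by omega), if_pos (by omega)]
      norm_num
    · rw [coord_onesExp, hco m₀ hm₀.le, if_pos hm₀, if_neg (by omega)]
      norm_num
  rwa [hg, HahnSeries.coeff_sub, sub_eq_zero] at this

variable (n r) in
/-- The coefficient of `u₁⁻¹⋯u_r⁻¹` in the iterated Laurent series field. -/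
def hahnResidue : IteratedResidue (K n) (H n r) r where
  C := HahnSeries.C
  v := natVar n r
  free := freeSubfield n r
  φ := HahnSeries.coeff.addMonoidHom (onesExp r)
  C_mem l a := single_mem_freeSubfield (zero_mem _) a
  v_mem i l h := single_mem_freeSubfield (neg_mem (expo_mem_freeExp h)) 1
  φ_C_mul a f := by
    show (HahnSeries.C a * f).coeff _ = a * f.coeff _
    rw [HahnSeries.C_mul_eq_smul, HahnSeries.coeff_smul, smul_eq_mul]
  φ_mul_pow l hl A hA j := by
    show (A * natVar n r l ^ j).coeff (onesExp r) = 0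
    have h := HahnSeries.coeff_mul_single_add (r := (1 : K n)) (x := A)
      (a := onesExp r + j • expo r l) (b := -(j • expo r l))
    rw [add_neg_cancel_right] at h
    rw [natVar_pow, h, mul_one]
    have hm : ((⟨r - 1 - l, by omega⟩ : Fin r) : ℕ) + l + 1 = r := by simp only; omega
    refine coeff_eq_zero_of_mem_freeSubfield hA ⟨r - 1 - l, by omega⟩ hm ?_
    rw [map_add, map_nsmul, coord_onesExp, coord_expo, if_pos hm]
    simp only [nsmul_eq_mul, mul_one]
    positivity
  φ_div_sub k hk A c hA hc := coeff_div_sub hk hA hc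
  φ_one := by
    show (∏ i ∈ Finset.Ico 0 r, (natVar n r i)⁻¹).coeff (onesExp r) = 1
    rw [prod_natVar_inv, lex_ext (g := ∑ i ∈ Finset.Ico 0 r, expo r i) (g' := onesExp r),
      HahnSeries.coeff_single_same]
    intro m
    rw [coord_sum_expo, coord_onesExp, if_pos (by have := m.2; omega)]

end Instance

/-- A permutation increasing beyond the first `r` places is determined by its first `r` values,
which are arbitrary distinct ones. -/
lemma sum_Cperm {n r : ℕ} (hrn : r ≤ n) {M : Type*} [AddCommMonoid M] (F : (Fin r → Fin n) → M) :
    ∑ w ∈ Cperm r n, F (fun i => w (Fin.castLE hrn i)) =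
      ∑ f : Fin r → Fin n with Function.Injective f ∧ ∀ i, f i ∈ (Finset.univ : Finset (Fin n)),
        F f := by
  have hcard : ∀ f : Fin r → Fin n, Function.Injective f →
      ((Finset.univ.image f)ᶜ).card = n - r := fun f hf => by
    rw [Finset.card_compl, Finset.card_image_of_injective _ hf]
    simp
  refine Finset.sum_bij (fun w _ i => w (Fin.castLE hrn i)) ?_ ?_ ?_ fun _ _ => rfl
  · intro w _
    simp only [Finset.mem_filter, Finset.mem_univ, true_and, implies_true, and_true]
    exact w.injective.comp (Fin.castLE_injective hrn)
  · intro w hw w' hw' h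
    have hf := w.injective.comp (Fin.castLE_injective hrn)
    have key : ∀ v : Equiv.Perm (Fin n), v ∈ Cperm r n →
        (fun i => v (Fin.castLE hrn i)) = (fun i => w (Fin.castLE hrn i)) →
        (fun i : Fin (n - r) => v ⟨i + r, by omega⟩) =
          (Finset.univ.image (w ∘ Fin.castLE hrn))ᶜ.orderEmbOfFin (hcard _ hf) := by
      intro v hv hvw
      refine Finset.orderEmbOfFin_unique _ (fun i => ?_) fun i j hij => ?_
      · simp only [Finset.mem_compl, Finset.mem_image, Finset.mem_univ, true_and, not_exists]
        intro j hj
        have := v.injective ((congrFun hvw j).trans hj)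
        have := congrArg Fin.val this
        simp only [Fin.val_castLE] at this
        omega
      · refine (Finset.mem_filter.1 hv).2 _ _ (by simp) ?_
        rw [Fin.mk_lt_mk]
        have : (i : ℕ) < j := hij
        omega
    have h2 := (key w hw rfl).trans (key w' hw' h.symm).symm
    ext i : 1
    by_cases hi : (i : ℕ) < r
    · exact congrFun h ⟨i, hi⟩
    · have := congrFun h2 ⟨i - r, by omega⟩
      simpa [Nat.sub_add_cancel (not_lt.1 hi)] using this
  · intro f hf
    simp only [Finset.mem_filter, Finset.mem_univ, true_and, implies_true, and_true] at hf
    set e := (Finset.univ.image f)ᶜ.orderEmbOfFin (hcard f hf) with he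
    have hef : ∀ i j, f i ≠ e j := fun i j h => by
      have := Finset.orderEmbOfFin_mem (Finset.univ.image f)ᶜ (hcard f hf) j
      rw [← he, ← h] at this
      simp at this
    let g : Fin n → Fin n := fun i => if h : (i : ℕ) < r then f ⟨i, h⟩ else e ⟨i - r, by omega⟩
    have hg : Function.Injective g := by
      intro i j hij
      simp only [g] at hij
      split_ifs at hij with hi hj hj
      · have := congrArg Fin.val (hf hij)
        exact Fin.ext this
      · exact absurd hij (hef _ _)
      · exact absurd hij.symm (hef _ _)
      · have := congrArg Fin.val (e.injective hij)
        simp only at this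
        exact Fin.ext (by omega)
    refine ⟨Equiv.ofBijective g (Finite.injective_iff_bijective.1 hg), ?_, ?_⟩
    · rw [Cperm, Finset.mem_filter]
      refine ⟨Finset.mem_univ _, fun i j hi hij => ?_⟩
      have hij' : (i : ℕ) < j := hij
      have hj : ¬ (j : ℕ) < r := by omega
      simp only [Equiv.ofBijective_apply, g, dif_neg (not_lt.2 hi), dif_neg hj]
      refine e.strictMono ?_
      rw [Fin.mk_lt_mk]
      omega
    · funext i
      simp [g]

lemma prod_range_eq_prod_Ioi {M : Type*} [CommMonoid M] {r : ℕ} (F : ℕ → ℕ → M) :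
    ∏ i : Fin r, ∏ j ∈ Finset.range i, F i j = ∏ i : Fin r, ∏ j ∈ Finset.Ioi i, F j i := by
  rw [Finset.prod_comm' (t' := Finset.univ) (s' := fun j : Fin r => Finset.Iio j) (by simp)]
  refine Finset.prod_congr rfl fun i _ => ?_
  rw [← Nat.Iio_eq_range, ← Fin.map_valEmbedding_Iio, Finset.prod_map]
  rfl

lemma x_injective (n : ℕ) : Function.Injective (x n) := fun _ _ h =>
  Sum.inl_injective (MvPolynomial.X_injective
    (IsFractionRing.injective (MvPolynomial (Fin n ⊕ ℕ) ℚ) (K n) h))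

lemma natVar_eq_u (n r : ℕ) (i : Fin r) : natVar n r i = u n r i := by
  rw [natVar, u]
  congr 2
  refine lex_ext fun m => ?_
  rw [map_neg, coord_expo]
  show _ = (Pi.single (Fin.rev i) (-1 : ℤ) : Fin r → ℤ) m
  rw [Pi.single_apply]
  have : (m : ℕ) + i + 1 = r ↔ m = Fin.rev i := by
    rw [Fin.ext_iff, Fin.val_rev]
    omega
  simp only [this]
  split_ifs <;> rfl

/-- The polynomial `(X + b₁)⋯(X + b_{ν_i - 1})`. -/
def factorialPower (n : ℕ) {r : ℕ} (nu : Fin r → ℕ) (i : ℕ) : Polynomial (K n) :=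
  if h : i < r then ∏ j ∈ Finset.range (nu ⟨i, h⟩ - 1), (Polynomial.X + Polynomial.C (b n j)) else 1

lemma factorialPower_coe (n : ℕ) {r : ℕ} (nu : Fin r → ℕ) (i : Fin r) :
    factorialPower n nu i = ∏ j ∈ Finset.range (nu i - 1), (Polynomial.X + Polynomial.C (b n j)) :=
  dif_pos i.2

lemma residueTerm_perm {n r : ℕ} (hrn : r ≤ n) (nu : Fin r → ℕ) (w : Equiv.Perm (Fin n)) :
    IteratedResidue.residueTerm (x n) (factorialPower n nu) r Finset.univ
      (fun i => w (Fin.castLE hrn i)) =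
      (∏ i : Fin r, (2 * x n (w (Fin.castLE hrn i)) *
          ∏ j ∈ Finset.range (nu i - 1), (x n (w (Fin.castLE hrn i)) + b n j))) *
      (∏ i : Fin r, ∏ j ∈ Finset.Ioi (Fin.castLE hrn i),
          (x n (w (Fin.castLE hrn i)) + x n (w j)) /
          (x n (w (Fin.castLE hrn i)) - x n (w j))) := by
  rw [IteratedResidue.residueTerm, ← Finset.prod_mul_distrib]
  refine Finset.prod_congr rfl fun i _ => ?_
  have h : Finset.univ.filter (fun c => ∀ j ≤ i, w (Fin.castLE hrn j) ≠ c) =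
      (Finset.Ioi (Fin.castLE hrn i)).map w.toEmbedding := by
    ext c
    obtain ⟨c, rfl⟩ := w.surjective c
    simp only [Finset.mem_filter, Finset.mem_univ, true_and, ne_eq, EmbeddingLike.apply_eq_iff_eq,
      Finset.mem_map_equiv, Equiv.symm_apply_apply, Finset.mem_Ioi]
    constructor
    · intro h
      by_contra! hc
      have hc' : (c : ℕ) ≤ i := hc
      exact h ⟨c, by omega⟩ hc rfl
    · rintro h j hj rfl
      exact absurd (lt_of_lt_of_le h hj) (lt_irrefl _)
  rw [h, Finset.prod_map, factorialPower_coe, Polynomial.eval_prod]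
  simp

lemma body_hahnResidue (n r : ℕ) (nu : Fin r → ℕ) :
    (hahnResidue n r).body (x n) (factorialPower n nu) r Finset.univ =
      ((∏ i : Fin r,
        ((∏ j : Fin n, (u n r i + HahnSeries.C (x n j)) / (u n r i - HahnSeries.C (x n j))) *
         (∏ j ∈ Finset.range (nu i - 1), (u n r i + HahnSeries.C (b n j)) / u n r i))) *
      (∏ i : Fin r, ∏ j ∈ Finset.Ioi i,
          (u n r j - u n r i) / (u n r j + u n r i))) * ∏ i : Fin r, u n r i ^ (nu i - 1) := by
  have hv : ∀ i : Fin r, (hahnResidue n r).v i = u n r i := natVar_eq_u n r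
  have hC : (hahnResidue n r).C = HahnSeries.C := rfl
  have key : ∏ i : Fin r, ((hahnResidue n r).quot (x n) Finset.univ (u n r i) *
      (factorialPower n nu i).eval₂ (hahnResidue n r).C (u n r i)) =
      (∏ i : Fin r,
        ((∏ j : Fin n, (u n r i + HahnSeries.C (x n j)) / (u n r i - HahnSeries.C (x n j))) *
         (∏ j ∈ Finset.range (nu i - 1), (u n r i + HahnSeries.C (b n j)) / u n r i))) *
        ∏ i : Fin r, u n r i ^ (nu i - 1) := by
    rw [← Finset.prod_mul_distrib]
    refine Finset.prod_congr rfl fun i _ => ?_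
    have hu : u n r i ≠ 0 := HahnSeries.single_ne_zero one_ne_zero
    rw [factorialPower_coe, Polynomial.eval₂_finsetProd, IteratedResidue.quot, hC, mul_assoc,
      Finset.prod_div_distrib (s := Finset.range _), Finset.prod_const, Finset.card_range,
      div_mul_cancel₀ _ (pow_ne_zero _ hu)]
    simp
  rw [IteratedResidue.body, Finset.prod_mul_distrib, Finset.prod_range, Finset.prod_range,
    prod_range_eq_prod_Ioi (fun i j => ((hahnResidue n r).v i - (hahnResidue n r).v j) /
      ((hahnResidue n r).v i + (hahnResidue n r).v j))]
  simp only [hv]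
  rw [key, mul_right_comm]

lemma prod_u_pow (n r : ℕ) (e : Fin r → ℕ) :
    ∏ i : Fin r, u n r i ^ e i = HahnSeries.single (-∑ i : Fin r, e i • expo r i) 1 := by
  rw [← Finset.sum_neg_distrib]
  simp only [← natVar_eq_u, natVar_pow]
  induction (Finset.univ : Finset (Fin r)) using Finset.cons_induction with
  | empty => rfl
  | cons a s ha ih =>
    rw [Finset.prod_cons, Finset.sum_cons, ih, HahnSeries.single_mul_single, mul_one]

lemma onesExp_add_sum {r : ℕ} (nu : Fin r → ℕ) (hpos : ∀ i, 0 < nu i) :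
    onesExp r + ∑ i : Fin r, (nu i - 1) • expo r i =
      toLex (fun k : Fin r => (nu (Fin.rev k) : ℤ)) := by
  refine lex_ext fun m => ?_
  rw [map_add, map_sum, coord_onesExp, Finset.sum_eq_single (Fin.rev m)]
  · rw [map_nsmul, coord_expo, if_pos (by rw [Fin.val_rev]; omega)]
    show _ = (nu (Fin.rev m) : ℤ)
    have := hpos (Fin.rev m)
    simp only [nsmul_eq_mul, mul_one]
    omega
  · intro i _ hi
    rw [map_nsmul, coord_expo, if_neg, smul_zero]
    intro h
    refine hi (Fin.ext ?_)
    rw [Fin.val_rev]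
    omega
  · simp

/-- **Generating function for the factorial Schur `Q`-polynomials
(additive specialization of the universal factorial Schur `Q`-functions).**

For a strict partition `ν_1 > ⋯ > ν_r > 0` of length `r ≤ n`,
`Q_ν(x_n|b) = Σ_{w ∈ C(r,n)} w·( ∏_i 2x_i ∏_{j=1}^{ν_i−1}(x_i+b_j)
  · ∏_i ∏_{j=i+1}^n (x_i+x_j)/(x_i−x_j) )`
equals the coefficient of `u_1^{−ν_1}⋯u_r^{−ν_r}` in
`∏_i ( ∏_{j=1}^n (u_i+x_j)/(u_i−x_j) · ∏_{j=1}^{ν_i−1} (u_i+b_j)/u_i )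
  · ∏_{1≤i<j≤r} (u_j−u_i)/(u_j+u_i)`. -/
theorem factorial_schur_Q_generating_function
    (n r : ℕ) (hr : 1 ≤ r) (hrn : r ≤ n)
    (nu : Fin r → ℕ) (hpos : ∀ i, 0 < nu i)
    (hstrict : ∀ i j : Fin r, i < j → nu j < nu i) :
    (∑ w ∈ Cperm r n,
      (∏ i : Fin r, (2 * x n (w (Fin.castLE hrn i)) *
          ∏ j ∈ Finset.range (nu i - 1), (x n (w (Fin.castLE hrn i)) + b n j))) *
      (∏ i : Fin r, ∏ j ∈ Finset.Ioi (Fin.castLE hrn i),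
          (x n (w (Fin.castLE hrn i)) + x n (w j)) /
          (x n (w (Fin.castLE hrn i)) - x n (w j))))
    =
    ((∏ i : Fin r,
        ((∏ j : Fin n, (u n r i + HahnSeries.C (x n j)) / (u n r i - HahnSeries.C (x n j))) *
         (∏ j ∈ Finset.range (nu i - 1), (u n r i + HahnSeries.C (b n j)) / u n r i))) *
      (∏ i : Fin r, ∏ j ∈ Finset.Ioi i,
          (u n r j - u n r i) / (u n r j + u n r i))).coeff
        (toLex (fun k : Fin r => (nu (Fin.rev k) : ℤ))) := by
  rw [← onesExp_add_sum nu hpos]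
  have h := (hahnResidue n r).φ_body_eq_sum (x n) (factorialPower n nu) (x_injective n) le_rfl
    Finset.univ
  rw [← sum_Cperm hrn (IteratedResidue.residueTerm (x n) (factorialPower n nu) r Finset.univ),
    body_hahnResidue, IteratedResidue.tail, Finset.Ico_self, Finset.prod_empty, mul_one,
    prod_u_pow] at h
  simp only [residueTerm_perm hrn nu] at h
  have hφ : ∀ f, (hahnResidue n r).φ f = f.coeff (onesExp r) := fun _ => rfl
  rw [← h, hφ]
  have h2 := fun f : H n r => HahnSeries.coeff_mul_single_add (r := (1 : K n)) (x := f)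
    (a := onesExp r + ∑ i : Fin r, (nu i - 1) • expo r i)
    (b := -∑ i : Fin r, (nu i - 1) • expo r i)
  simp only [add_neg_cancel_right, mul_one] at h2
  rw [h2]
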